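/- arXiv:2605.01984 — 4 statements merged into one kernel-verified Lean document; each statement's English description precedes it below -/
import Mathlib

section
/- Let O be a henselian valuation ring with fraction field K, and let L be a Galois (possibly infinite) algebraic field extension of K. Then the integral closure of O in L is again a valuation ring, and L is its fraction field (every element of L is a ratio of two elements of the integral closure). -/
open Polynomial Pointwise in
/-- Key lemma: henselianity forces every maximal ideal to be stable under the group. -/
theorem aux_stable {A B G : Type*} [CommRing A] [HenselianLocalRing A] [CommRing B] [IsDomain B]
    [Algebra A B] [Group G] [Finite G] [MulSemiringAction G B] [SMulCommClass G A B]
    [Algebra.IsInvariant A B G] (M : Ideal B) [hM : M.IsMaximal] (g : G) : g • M = M := by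
  classical
  cases nonempty_fintype G
  have hint : Algebra.IsIntegral A B := Algebra.IsInvariant.isIntegral A B G
  have hcm : M.comap (algebraMap A B) = IsLocalRing.maximalIdeal A :=
    IsLocalRing.eq_maximalIdeal (Ideal.isMaximal_comap_of_isIntegral_of_isMaximal M)
  have hmem : ∀ a : A, algebraMap A B a ∈ M ↔ a ∈ IsLocalRing.maximalIdeal A := by
    intro a; rw [← hcm, Ideal.mem_comap]
  have hmax : ∀ h : G, (h • M).IsMaximal := by
    intro h
    rw [Ideal.pointwise_smul_eq_comap]
    exact Ideal.comap_isMaximal_of_equiv (MulSemiringAction.toRingEquiv G B h).symm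
  -- choose an element outside `M` lying in all the other conjugates
  obtain ⟨y, hy, hyM⟩ : ∃ y, (∀ h : G, h • M ≠ M → y ∈ h • M) ∧ y ∉ M := by
    by_contra! hcon
    have hle : (Finset.univ.filter (fun h : G => h • M ≠ M)).inf (fun h => h • M) ≤ M := by
      intro y hy
      apply hcon
      intro h hh
      exact (Finset.inf_le (f := fun h : G => h • M) (by simpa using hh) : _ ≤ h • M) hy
    obtain ⟨h, hh, hle'⟩ := (Ideal.IsPrime.inf_le' hM.isPrime).1 hle
    have : h • M ≠ M := by simpa using hh
    exact this ((hmax h).eq_of_le hM.ne_top hle')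
  let D := MulAction.stabilizer G M
  let β : B := ∏ h : D, (h : G) • y
  have hβD : ∀ h : G, h • M = M → h • β = β := by
    intro h hh
    simp only [β, Finset.smul_prod', smul_smul]
    let h' : D := ⟨h, hh⟩
    exact Fintype.prod_equiv (Equiv.mulLeft h') _ _ (fun x => rfl)
  have hβM : β ∉ M := by
    intro hb
    obtain ⟨h, -, hh⟩ := (hM.isPrime.prod_mem_iff).1 hb
    have : (h : G) • y ∈ (h : G) • M := by
      rw [show (h : G) • M = M from h.2]; exact hh
    exact hyM (Ideal.smul_mem_pointwise_smul_iff.1 this)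
  have hβo : ∀ h : G, h • M ≠ M → h • β ∈ M := by
    intro h hh
    rw [← Ideal.mem_inv_pointwise_smul_iff]
    have h1 : h⁻¹ • M ≠ M := by
      intro e; apply hh; rw [inv_smul_eq_iff] at e; exact e.symm
    have h2 : y ∈ h⁻¹ • M := hy _ h1
    have : β = y * ∏ x ∈ Finset.univ.erase (1 : D), (x : G) • y := by
      have := Finset.mul_prod_erase Finset.univ (fun x : D => (x : G) • y) (Finset.mem_univ 1)
      simp only [OneMemClass.coe_one, one_smul] at this
      exact this.symm
    rw [this]
    exact Ideal.mul_mem_right _ _ h2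
  let S : Finset B := Finset.univ.image (fun h : G => h • β)
  have hS : ∀ (h : G) (b : B), b ∈ S ↔ h • b ∈ S := by
    intro h b
    simp only [S, Finset.mem_image, Finset.mem_univ, true_and]
    constructor
    · rintro ⟨k, rfl⟩; exact ⟨h * k, mul_smul _ _ _⟩
    · rintro ⟨k, hk⟩; exact ⟨h⁻¹ * k, by rw [mul_smul, hk, inv_smul_smul]⟩
  have hβS : β ∈ S := Finset.mem_image.2 ⟨1, Finset.mem_univ _, one_smul _ _⟩
  have hSM : ∀ b ∈ S.erase β, b ∈ M := by
    intro b hb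
    obtain ⟨hb1, hb2⟩ := Finset.mem_erase.1 hb
    obtain ⟨h, -, rfl⟩ := Finset.mem_image.1 hb2
    apply hβo
    intro e
    exact hb1 (hβD h e)
  let F : B[X] := ∏ b ∈ S, (X - C b)
  have hFs : ∀ h : G, h • F = F := by
    intro h
    simp only [F, Finset.smul_prod']
    refine Finset.prod_bijective (fun b => h • b) (MulAction.bijective h) (hS h) ?_
    intro b _
    rw [smul_sub, smul_X, smul_C]
  have hFm : F.Monic := monic_prod_of_monic _ _ fun _ _ => monic_X_sub_C _
  have hFl : F ∈ lifts (algebraMap A B) := by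
    rw [lifts_iff_coeff_lifts]
    intro n
    obtain ⟨a, ha⟩ := Algebra.IsInvariant.isInvariant (A := A) (G := G) (F.coeff n) (by
      intro h
      rw [← Polynomial.coeff_smul, hFs])
    exact ⟨a, ha⟩
  obtain ⟨p, hpF, -, hpm⟩ := lifts_and_natDegree_eq_and_monic hFl hFm
  obtain ⟨a₀, ha₀⟩ := Algebra.IsInvariant.isInvariant (A := A) (G := G) (∑ b ∈ S, b) (by
      intro h
      rw [Finset.smul_sum]
      exact Finset.sum_bijective (fun b => h • b) (MulAction.bijective h) (hS h) (fun b _ => rfl))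
  have ha₀β : algebraMap A B a₀ - β ∈ M := by
    rw [ha₀, ← Finset.add_sum_erase S _ hβS, add_sub_cancel_left]
    exact Ideal.sum_mem _ hSM
  have ha₀M : algebraMap A B a₀ ∉ M := by
    intro hc
    apply hβM
    have := M.sub_mem hc ha₀β
    simpa using this
  let H : B[X] := ∏ b ∈ S.erase β, (X - C b)
  have hFH : F = (X - C β) * H := (Finset.mul_prod_erase S (fun b => X - C b) hβS).symm
  have hev : ∀ (q : A[X]) (a : A),
      algebraMap A B (q.eval a) = (q.map (algebraMap A B)).eval (algebraMap A B a) := by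
    intro q a; rw [eval_map_algebraMap, aeval_algebraMap_apply_eq_algebraMap_eval]
  have h1 : p.eval a₀ ∈ IsLocalRing.maximalIdeal A := by
    rw [← hmem, hev, hpF, hFH]
    simp only [eval_mul, eval_sub, eval_X, eval_C]
    exact Ideal.mul_mem_right _ _ ha₀β
  have h2 : IsUnit (p.derivative.eval a₀) := by
    rw [← IsLocalRing.notMem_maximalIdeal, ← hmem, hev, ← derivative_map, hpF, hFH]
    simp only [derivative_mul, derivative_sub, derivative_X, derivative_C, sub_zero, one_mul,
      eval_add, eval_mul, eval_sub, eval_X, eval_C]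
    intro hc
    have h3 : H.eval (algebraMap A B a₀) ∈ M :=
      (M.add_mem_iff_left (Ideal.mul_mem_right _ _ ha₀β)).1 hc
    simp only [H, eval_prod, eval_sub, eval_X, eval_C] at h3
    obtain ⟨b, hb, hb'⟩ := (hM.isPrime.prod_mem_iff).1 h3
    apply ha₀M
    simpa using M.add_mem hb' (hSM b hb)
  obtain ⟨a, ha, -⟩ := HenselianLocalRing.is_henselian p hpm a₀ h1 h2
  have hFa : F.eval (algebraMap A B a) = 0 := by
    rw [← hpF, ← hev, ha.eq_zero, map_zero]
  simp only [F, eval_prod, eval_sub, eval_X, eval_C, Finset.prod_eq_zero_iff] at hFa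
  obtain ⟨b, hb, hb'⟩ := hFa
  obtain ⟨h, -, rfl⟩ := Finset.mem_image.1 hb
  have hβa : β = algebraMap A B a := by
    have := congrArg (fun t => h⁻¹ • t) (sub_eq_zero.1 hb')
    simp only [inv_smul_smul, smul_algebraMap] at this
    exact this.symm
  by_contra hg
  have := hβo g hg
  rw [hβa, smul_algebraMap, ← hβa] at this
  exact hβM this

open Pointwise in
theorem aux_local {A B G : Type*} [CommRing A] [HenselianLocalRing A] [CommRing B] [IsDomain B]
    [Algebra A B] [Group G] [Finite G] [MulSemiringAction G B] [SMulCommClass G A B]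
    [Algebra.IsInvariant A B G] : IsLocalRing B := by
  have hint : Algebra.IsIntegral A B := Algebra.IsInvariant.isIntegral A B G
  obtain ⟨M, hM⟩ := Ideal.exists_maximal B
  refine IsLocalRing.of_unique_max_ideal ⟨M, hM, ?_⟩
  intro N hN
  have e : M.under A = N.under A := by
    have h1 := IsLocalRing.eq_maximalIdeal
      (Ideal.isMaximal_comap_of_isIntegral_of_isMaximal (R := A) M)
    have h2 := IsLocalRing.eq_maximalIdeal
      (Ideal.isMaximal_comap_of_isIntegral_of_isMaximal (R := A) N)
    exact h1.trans h2.symm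
  have := hM.isPrime
  have := hN.isPrime
  obtain ⟨g, hg⟩ := Algebra.IsInvariant.exists_smul_of_under_eq A B G M N e
  rw [hg, aux_stable (A := A) M g]

open Polynomial in
theorem aux_inv {B E : Type*} [CommRing B] [IsLocalRing B] [Field E] [Algebra B E]
    (hinj : Function.Injective (algebraMap B E))
    (hcl : ∀ x : E, IsIntegral B x → ∃ b, algebraMap B E b = x) (x : E) (n : ℕ) :
    ∀ f : B[X], f.natDegree ≤ n → aeval x f = 0 → (∃ i, IsUnit (f.coeff i)) →
      (∃ b, algebraMap B E b = x) ∨ (∃ b, algebraMap B E b = x⁻¹) := by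
  induction n with
  | zero =>
    intro f hf hx ⟨i, hi⟩
    exfalso
    rw [Nat.le_zero] at hf
    obtain ⟨c, rfl⟩ := natDegree_eq_zero.1 hf
    rw [aeval_C, map_eq_zero_iff _ hinj] at hx
    subst hx
    simp at hi
  | succ n ih =>
    intro f hf hx hu
    by_cases hd : f.natDegree ≤ n
    · exact ih f hd hx hu
    have hd : f.natDegree = n + 1 := by omega
    obtain ⟨c, hc⟩ := hcl _ (isIntegral_leadingCoeff_smul f x hx)
    rw [Algebra.smul_def] at hc
    set l := f.leadingCoeff with hl
    -- remaining polynomial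
    let g : B[X] := f.eraseLead + C c * X ^ n
    have hgd : g.natDegree ≤ n := by
      refine natDegree_add_le_of_degree_le ?_ (natDegree_C_mul_X_pow_le _ _)
      have := f.eraseLead_natDegree_le
      omega
    have hgx : aeval x g = 0 := by
      have h1 : aeval x f = aeval x f.eraseLead + algebraMap B E l * x ^ (n + 1) := by
        conv_lhs => rw [← f.eraseLead_add_C_mul_X_pow]
        simp [hd, hl]
      rw [hx] at h1
      simp only [g, map_add, map_mul, aeval_C, map_pow, aeval_X, hc]
      rw [h1]; ring
    have hgc : ∀ i, i < n → g.coeff i = f.coeff i := by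
      intro i hi
      simp only [g, coeff_add, coeff_C_mul, coeff_X_pow]
      rw [eraseLead_coeff_of_ne _ (by omega), if_neg (by omega)]; simp
    have hgn : g.coeff n = f.coeff n + c := by
      simp only [g, coeff_add, coeff_C_mul, coeff_X_pow]
      rw [eraseLead_coeff_of_ne _ (by omega)]; simp
    obtain ⟨i, hi⟩ := hu
    rcases lt_trichotomy i n with h | h | h
    · exact ih g hgd hgx ⟨i, by rw [hgc i h]; exact hi⟩
    · subst h
      have : f.coeff i = g.coeff i + -c := by rw [hgn]; ring
      rw [this] at hi
      rcases IsLocalRing.isUnit_or_isUnit_of_isUnit_add hi with h | h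
      · exact ih g hgd hgx ⟨i, h⟩
      · right
        rw [IsUnit.neg_iff] at h
        obtain ⟨u, rfl⟩ := h
        refine ⟨l * (u⁻¹ : Bˣ), ?_⟩
        have h3 : algebraMap B E (u : B) * algebraMap B E ((u⁻¹ : Bˣ) : B) = 1 := by
          rw [← map_mul]; simp
        rw [map_mul]
        apply eq_inv_of_mul_eq_one_left
        rw [← h3, hc]; ring
    · left
      have : i = n + 1 := by
        by_contra hne
        rw [coeff_eq_zero_of_natDegree_lt (by omega)] at hi
        simp at hi
      subst this
      rw [← hd, coeff_natDegree] at hi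
      obtain ⟨u, hu⟩ := hi
      refine ⟨c * (u⁻¹ : Bˣ), ?_⟩
      have h3 : algebraMap B E (u : B) * algebraMap B E ((u⁻¹ : Bˣ) : B) = 1 := by
        rw [← map_mul]; simp
      rw [map_mul, hc, hl, ← hu]
      rw [mul_right_comm, h3, one_mul]

theorem aux_min {O ι : Type*} [CommRing O] [IsDomain O] [ValuationRing O] (f : ι → O)
    (s : Finset ι) (hs : s.Nonempty) : ∃ i ∈ s, ∀ j ∈ s, f i ∣ f j := by
  classical
  induction hs using Finset.Nonempty.cons_induction with
  | singleton a => exact ⟨a, by simp⟩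
  | cons a s ha hs ih =>
    obtain ⟨i, hi, h⟩ := ih
    rcases ValuationRing.dvd_total (f i) (f a) with h' | h'
    · refine ⟨i, by simp [hi], ?_⟩
      intro j hj
      rcases Finset.mem_cons.1 hj with rfl | hj
      · exact h'
      · exact h j hj
    · refine ⟨a, by simp, ?_⟩
      intro j hj
      rcases Finset.mem_cons.1 hj with rfl | hj
      · exact dvd_rfl
      · exact h'.trans (h j hj)

open Polynomial in
theorem aux_finite (O K E : Type*) [CommRing O] [IsDomain O] [ValuationRing O]
    [HenselianLocalRing O] [Field K] [Algebra O K] [IsFractionRing O K]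
    [Field E] [Algebra K E] [FiniteDimensional K E] [IsGalois K E]
    [Algebra O E] [IsScalarTower O K E] (x : E) : IsIntegral O x ∨ IsIntegral O x⁻¹ := by
  classical
  let B := integralClosure O E
  have hfr : IsFractionRing B E := integralClosure.isFractionRing_of_finite_extension K E
  have hinv : Algebra.IsInvariant O B (B ≃ₐ[O] B) := Algebra.isInvariant_of_isGalois' O K E B
  have hfin : Finite (B ≃ₐ[O] B) := Finite.of_equiv _ (galRestrict O K E B).toEquiv
  have hloc : IsLocalRing B := aux_local (A := O) (B := B) (G := B ≃ₐ[O] B)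
  have halg : IsAlgebraic O x :=
    (IsFractionRing.isAlgebraic_iff O K E).2 (Algebra.IsAlgebraic.isAlgebraic x)
  obtain ⟨f, hf0, hfx⟩ := halg
  obtain ⟨i, hi, hmin⟩ := aux_min f.coeff f.support (support_nonempty.2 hf0)
  have hd : C (f.coeff i) ∣ f := by
    rw [C_dvd_iff_dvd_coeff]
    intro j
    by_cases hj : j ∈ f.support
    · exact hmin j hj
    · rw [notMem_support_iff.1 hj]; exact dvd_zero _
  obtain ⟨g, hg⟩ := hd
  have hne : f.coeff i ≠ 0 := mem_support_iff.1 hi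
  have hgi : g.coeff i = 1 := by
    have := congrArg (fun q => q.coeff i) hg
    simp only [coeff_C_mul] at this
    exact mul_left_cancel₀ hne (by rw [← this, mul_one])
  have hinjO : Function.Injective (algebraMap O E) := by
    rw [IsScalarTower.algebraMap_eq O K E]
    exact (algebraMap K E).injective.comp (IsFractionRing.injective O K)
  have hgx : aeval x g = 0 := by
    rw [hg, map_mul, aeval_C, mul_eq_zero] at hfx
    refine hfx.resolve_left ?_
    rw [map_eq_zero_iff _ hinjO]; exact hne
  have key := aux_inv (B := B) (E := E) Subtype.val_injective
    (fun z hz => ⟨⟨z, isIntegral_trans (R := O) (A := B) z hz⟩, rfl⟩) x _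
    (g.map (algebraMap O B)) le_rfl (by rw [aeval_map_algebraMap]; exact hgx)
    ⟨i, by rw [coeff_map, hgi, map_one]; exact isUnit_one⟩
  rcases key with ⟨b, hb⟩ | ⟨b, hb⟩
  · left; rw [← hb]; exact b.2
  · right; rw [← hb]; exact b.2


/-- The integral closure of a henselian valuation ring `O` in a Galois (possibly infinite)
extension `L` of its fraction field `K` is again a valuation ring, and `L` is its fraction
field: every element of `L` is a ratio of two elements of the integral closure. -/
theorem statement_0 (O K L : Type*) [CommRing O] [IsDomain O] [ValuationRing O]
    [HenselianLocalRing O] [Field K] [Algebra O K] [IsFractionRing O K]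
    [Field L] [Algebra K L] [IsGalois K L]
    [Algebra O L] [IsScalarTower O K L] :
    ValuationRing (integralClosure O L) ∧
      ∀ x : L, ∃ a b : integralClosure O L, b ≠ 0 ∧ x = (a : L) / (b : L) := by
  have key : ∀ x : L, IsIntegral O x ∨ IsIntegral O x⁻¹ := by
    intro x
    let F := FiniteGaloisIntermediateField.adjoin K ({x} : Set L)
    have hx : x ∈ F.toIntermediateField :=
      FiniteGaloisIntermediateField.subset_adjoin K ({x} : Set L) rfl
    let y : F.toIntermediateField := ⟨x, hx⟩
    let φ : F.toIntermediateField →ₐ[O] L := F.toIntermediateField.val.restrictScalars O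
    rcases aux_finite O K F.toIntermediateField y with h | h
    · exact Or.inl (h.map φ)
    · exact Or.inr (h.map φ)
  constructor
  · refine ValuationRing.iff_dvd_total.2 ⟨fun a b => ?_⟩
    by_cases hb : b = 0
    · exact Or.inl (by rw [hb]; exact dvd_zero _)
    by_cases ha : a = 0
    · exact Or.inr (by rw [ha]; exact dvd_zero _)
    have ha' : (a : L) ≠ 0 := fun h => ha (Subtype.ext h)
    have hb' : (b : L) ≠ 0 := fun h => hb (Subtype.ext h)
    rcases key ((b : L) / a) with h | h
    · exact Or.inl ⟨⟨_, h⟩, Subtype.ext (mul_div_cancel₀ (b : L) ha').symm⟩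
    · rw [inv_div] at h
      exact Or.inr ⟨⟨_, h⟩, Subtype.ext (mul_div_cancel₀ (a : L) hb').symm⟩
  · intro x
    by_cases hx : x = 0
    · exact ⟨0, 1, one_ne_zero, by simp [hx]⟩
    rcases key x with h | h
    · exact ⟨⟨x, h⟩, 1, one_ne_zero, by simp⟩
    · refine ⟨1, ⟨_, h⟩, ?_, by simp⟩
      intro e
      exact inv_ne_zero hx (congrArg Subtype.val e)
end

section
/- Let O be a henselian valuation ring with fraction field K, and let L be a Galois (possibly infinite) algebraic field extension of K, with O' the integral closure of O in L. Then the map of prime spectra Spec(O') → Spec(O) induced by the inclusion O ⊆ O' is a homeomorphism; in particular, for every prime ideal p of O there is exactly one prime ideal of O' lying over p. -/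
open Polynomial in
theorem aux_local_s2 {O K L : Type*} [CommRing O] [IsDomain O] [ValuationRing O]
    [HenselianLocalRing O] [Field K] [Algebra O K] [IsFractionRing O K]
    [Field L] [Algebra K L] [IsGalois K L] [FiniteDimensional K L]
    [Algebra O L] [IsScalarTower O K L] :
    IsLocalRing (integralClosure O L) := by
  classical
  refine IsLocalRing.of_unique_max_ideal ?_
  obtain ⟨M, hM⟩ := Ideal.exists_maximal (integralClosure O L)
  refine ⟨M, hM, ?_⟩
  intro N hN
  by_contra hNM
  have hinjOL : Function.Injective (algebraMap O L) := by
    rw [IsScalarTower.algebraMap_eq O K L]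
    exact (algebraMap K L).injective.comp (IsFractionRing.injective O K)
  let φ : (L ≃ₐ[K] L) → (integralClosure O L ≃ₐ[O] integralClosure O L) :=
    fun σ => (σ.restrictScalars O).mapIntegralClosure
  have hφ : ∀ σ x, ((φ σ x : integralClosure O L) : L) = σ x := fun σ x => rfl
  have hφmul : ∀ σ τ x, φ (σ * τ) x = φ σ (φ τ x) := fun σ τ x => rfl
  have hφone : ∀ x, φ 1 x = x := fun x => rfl
  let P : (L ≃ₐ[K] L) → Ideal (integralClosure O L) := fun σ => M.comap (φ σ)
  have hPmem : ∀ σ x, x ∈ P σ ↔ φ σ x ∈ M := fun σ x => Iff.rfl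
  have hPmax : ∀ σ, (P σ).IsMaximal := fun σ =>
    Ideal.comap_isMaximal_of_surjective (φ σ) (φ σ).surjective
  have key : ∀ Q : Ideal (integralClosure O L), Q.IsMaximal → Q ≠ M → ∃ b ∈ Q, b - 1 ∈ M := by
    intro Q hQ hne
    have := (Ideal.isCoprime_iff_exists).1 (Ideal.isCoprime_of_isMaximal hne)
    obtain ⟨i, hi, j, hj, hij⟩ := this
    refine ⟨i, hi, ?_⟩
    rw [← hij]
    simpa using hj
  have hmod : ∀ x : integralClosure O L, x - 1 ∈ M ↔ Ideal.Quotient.mk M x = 1 := by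
    intro x
    rw [← map_one (Ideal.Quotient.mk M), Ideal.Quotient.eq]
  have key2 : ∀ σ, ∃ b, (P σ ≠ M → b ∈ P σ) ∧ b - 1 ∈ M := by
    intro σ
    by_cases h : P σ = M
    · exact ⟨1, fun h' => (h' h).elim, by simp⟩
    · obtain ⟨b, h1, h2⟩ := key _ (hPmax σ) h
      exact ⟨b, fun _ => h1, h2⟩
  choose b hb1 hb2 using key2
  obtain ⟨ν, hν1, hν2⟩ := key N hN hNM
  set β := ν * ∏ σ, b σ with hβ
  have hβN : β ∈ N := Ideal.mul_mem_right _ _ hν1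
  have hβM : β - 1 ∈ M := by
    rw [hmod, hβ, map_mul, map_prod, (hmod _).1 hν2, one_mul]
    exact Finset.prod_eq_one fun σ _ => (hmod _).1 (hb2 σ)
  have hβP : ∀ σ, P σ ≠ M → β ∈ P σ := fun σ h =>
    Ideal.mul_mem_left _ _ (Ideal.mem_of_dvd _ (Finset.dvd_prod_of_mem b (Finset.mem_univ σ)) (hb1 σ h))
  let D : Finset (L ≃ₐ[K] L) := Finset.univ.filter fun σ => P σ = M
  have hPmul : ∀ σ τ, P (σ * τ) = (P σ).comap (φ τ) := fun σ τ => rfl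
  have hD : ∀ σ, σ ∈ D ↔ P σ = M := fun σ => by simp [D]
  have h1D : (1 : L ≃ₐ[K] L) ∈ D := (hD _).2 rfl
  set γ := ∏ σ ∈ D, φ σ β with hγ
  have hβγ : β ∣ γ := Finset.dvd_prod_of_mem (fun σ => φ σ β) h1D
  have hγN : γ ∈ N := Ideal.mem_of_dvd _ hβγ hβN
  have hγM : γ - 1 ∈ M := by
    rw [hmod, hγ, map_prod]
    refine Finset.prod_eq_one fun σ hσ => (hmod _).1 ?_
    have : β - 1 ∈ P σ := by rw [(hD σ).1 hσ]; exact hβM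
    rw [hPmem, map_sub, map_one] at this
    exact this
  have hfix : ∀ σ, P σ = M → φ σ γ = γ := by
    intro σ hσ
    rw [hγ, map_prod]
    refine Finset.prod_bij (fun τ _ => σ * τ) ?_ ?_ ?_ ?_
    · intro τ hτ
      rw [hD] at hτ ⊢
      rw [hPmul, hσ]; exact hτ
    · intro τ _ τ' _ h
      exact mul_left_cancel h
    · intro τ hτ
      refine ⟨σ⁻¹ * τ, ?_, by simp⟩
      rw [hD] at hτ ⊢
      have h2 : P σ⁻¹ = M := by
        have : P (σ * σ⁻¹) = (P σ).comap (φ σ⁻¹) := hPmul _ _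
        rw [hσ, mul_inv_cancel] at this
        exact this.symm
      rw [hPmul, h2]; exact hτ
    · intro τ _
      rfl
  have hnot : ∀ σ, P σ ≠ M → φ σ γ ∈ M := fun σ h =>
    (hPmem _ _).1 (Ideal.mem_of_dvd _ hβγ (hβP σ h))
  let S : Finset (integralClosure O L) := Finset.univ.image fun σ => φ σ γ
  have hγS : γ ∈ S := Finset.mem_image.2 ⟨1, Finset.mem_univ _, rfl⟩
  let F : (integralClosure O L)[X] := ∏ s ∈ S, (X - C s)
  have hFmonic : F.Monic := monic_prod_of_monic _ _ fun s _ => monic_X_sub_C s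
  have hFinv : ∀ σ, F.map (φ σ : integralClosure O L →+* integralClosure O L) = F := by
    intro σ
    simp only [F, Polynomial.map_prod, Polynomial.map_sub, map_X, map_C]
    refine Finset.prod_bij (fun s _ => φ σ s) ?_ ?_ ?_ ?_
    · intro s hs
      obtain ⟨τ, -, rfl⟩ := Finset.mem_image.1 hs
      exact Finset.mem_image.2 ⟨σ * τ, Finset.mem_univ _, rfl⟩
    · intro s _ t _ h
      exact (φ σ).injective h
    · intro s hs
      obtain ⟨τ, -, rfl⟩ := Finset.mem_image.1 hs
      refine ⟨φ (σ⁻¹ * τ) γ, Finset.mem_image.2 ⟨_, Finset.mem_univ _, rfl⟩, ?_⟩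
      rw [← hφmul, mul_inv_cancel_left]
    · intro s _
      rfl
  have hcoef : ∀ n, F.coeff n ∈ (algebraMap O (integralClosure O L)).range := by
    intro n
    have h1 : ∀ σ : L ≃ₐ[K] L, σ (F.coeff n : L) = F.coeff n := by
      intro σ
      rw [← hφ]
      congr 1
      conv_rhs => rw [← hFinv σ, coeff_map]
      rfl
    obtain ⟨k, hk⟩ := (IsGalois.mem_range_algebraMap_iff_fixed (F := K) (F.coeff n : L)).2 h1
    have h2 : IsIntegral O k := by
      have : IsIntegral O (algebraMap K L k) := by rw [hk]; exact (F.coeff n).2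
      exact (isIntegral_algebraMap_iff (algebraMap K L).injective).1 this
    obtain ⟨o, ho⟩ := IsIntegrallyClosed.isIntegral_iff.1 h2
    refine ⟨o, Subtype.ext ?_⟩
    rw [← hk, ← ho, ← IsScalarTower.algebraMap_apply]
    rfl
  have hlift : F ∈ Polynomial.lifts (algebraMap O (integralClosure O L)) := by
    rw [lifts_iff_coeff_lifts]
    exact hcoef
  obtain ⟨f, hfF, -, hfm⟩ := lifts_and_degree_eq_and_monic hlift hFmonic
  have hcomap : ∀ Q : Ideal (integralClosure O L), Q.IsMaximal → ∀ o : O,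
      algebraMap O (integralClosure O L) o ∈ Q ↔ o ∈ IsLocalRing.maximalIdeal O := by
    intro Q hQ o
    have := Ideal.isMaximal_comap_of_isIntegral_of_isMaximal (R := O) Q
    rw [← IsLocalRing.eq_maximalIdeal this, Ideal.mem_comap]
  have hFfac : F = (X - C γ) * ∏ s ∈ S.erase γ, (X - C s) := 
    (Finset.mul_prod_erase S (fun s => X - C s) hγS).symm
  have hγM' : Ideal.Quotient.mk M γ = 1 := (hmod _).1 hγM
  have hother : Ideal.Quotient.mk M (eval 1 (∏ s ∈ S.erase γ, (X - C s))) = 1 := by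
    rw [eval_prod, map_prod]
    refine Finset.prod_eq_one fun s hs => ?_
    obtain ⟨hne, hs⟩ := Finset.mem_erase.1 hs
    obtain ⟨τ, -, rfl⟩ := Finset.mem_image.1 hs
    have h3 : P τ ≠ M := fun h => hne (hfix τ h)
    have := Ideal.Quotient.eq_zero_iff_mem.2 (hnot τ h3)
    simp only [eval_sub, eval_X, eval_C, map_sub, map_one]
    rw [this, sub_zero]
  have hev : ∀ g : O[X], algebraMap O (integralClosure O L) (g.eval 1)
      = (g.map (algebraMap O (integralClosure O L))).eval 1 := by
    intro g
    rw [← map_one (algebraMap O (integralClosure O L)), eval_map, eval₂_at_apply]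
  have hf1 : f.eval 1 ∈ IsLocalRing.maximalIdeal O := by
    rw [← hcomap M hM, hev, hfF, hFfac, ← Ideal.Quotient.eq_zero_iff_mem]
    simp [hγM']
  have hf2 : IsUnit (f.derivative.eval 1) := by
    rw [← IsLocalRing.notMem_maximalIdeal, ← hcomap M hM, hev, ← derivative_map, hfF, hFfac,
      ← Ideal.Quotient.eq_zero_iff_mem, derivative_mul, eval_add, eval_mul, eval_mul, map_add,
      map_mul, map_mul, hother]
    have := Ideal.Quotient.nontrivial_iff.2 hM.ne_top
    simp [hγM']
  obtain ⟨a, ha, ha1⟩ := HenselianLocalRing.is_henselian f hfm 1 hf1 hf2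
  have hroot : F.eval (algebraMap O _ a) = 0 := by
    rw [← hfF, eval_map, eval₂_at_apply, ha.eq_zero, map_zero]
  obtain ⟨s, hs, hs0⟩ : ∃ s ∈ S, algebraMap O (integralClosure O L) a - s = 0 := by
    simpa [F, eval_prod, Finset.prod_eq_zero_iff] using hroot
  obtain ⟨τ, -, rfl⟩ := Finset.mem_image.1 hs
  have hγa : γ = algebraMap O (integralClosure O L) a := by
    apply (φ τ).injective
    rw [AlgEquiv.commutes]
    exact (sub_eq_zero.1 hs0).symm
  have haN : a ∈ IsLocalRing.maximalIdeal O := by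
    rw [← hcomap N hN, ← hγa]; exact hγN
  have : (1 : O) ∈ IsLocalRing.maximalIdeal O := by
    have := sub_mem haN ha1
    simpa using this
  exact (Ideal.ne_top_iff_one _).1 (IsLocalRing.maximalIdeal.isMaximal O).ne_top this

open Polynomial in
theorem aux_kap {O L : Type*} [CommRing O] [Field L] [Algebra O L]
    [IsLocalRing (integralClosure O L)] (x : L) (n : ℕ) :
    ∀ p : (integralClosure O L)[X], p.natDegree ≤ n → (∃ k, IsUnit (p.coeff k)) →
      aeval x p = 0 → IsIntegral O x ∨ IsIntegral O x⁻¹ := by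
  have hu : ∀ y : integralClosure O L, IsUnit y → IsIntegral O ((y : L)⁻¹) ∧ (y : L) ≠ 0 := by
    rintro y ⟨u, rfl⟩
    have h : ((u : integralClosure O L) : L) * ((u⁻¹ : (integralClosure O L)ˣ) : integralClosure O L) = 1 := by
      rw [← MulMemClass.coe_mul, Units.mul_inv]; rfl
    rw [inv_eq_of_mul_eq_one_right h]
    exact ⟨Subtype.property _, left_ne_zero_of_mul_eq_one h⟩
  induction n with
  | zero =>
    rintro p hp ⟨k, hk⟩ h0
    rw [eq_C_of_natDegree_le_zero hp] at hk h0
    rw [aeval_C] at h0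
    have hk0 : IsUnit (p.coeff 0) := by
      rcases Nat.eq_zero_or_pos k with rfl | h
      · simpa using hk
      · rw [coeff_C_of_ne_zero h.ne'] at hk
        exact (not_isUnit_zero hk).elim
    exact ((hu _ hk0).2 h0).elim
  | succ n ih =>
    rintro p hp ⟨k, hk⟩ h0
    rcases Nat.lt_or_ge p.natDegree (n+1) with hlt | hge
    · exact ih p (by omega) ⟨k, hk⟩ h0
    have hdeg : p.natDegree = n + 1 := le_antisymm hp hge
    set c := p.leadingCoeff with hc
    have hint : IsIntegral O ((c : L) * x) := by
      have := isIntegral_leadingCoeff_smul p x h0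
      exact isIntegral_trans (A := integralClosure O L) _ this
    let y : integralClosure O L := ⟨(c : L) * x, hint⟩
    have hy : (y : L) = c * x := rfl
    by_cases hyu : IsUnit y
    · right
      have h1 := hu y hyu
      have hx : x ≠ 0 := fun h => h1.2 (by rw [hy, h, mul_zero])
      have hc0 : (c : L) ≠ 0 := fun h => h1.2 (by rw [hy, h, zero_mul])
      have : x⁻¹ = (c : L) * (y : L)⁻¹ := by rw [hy]; field_simp
      rw [this]
      exact IsIntegral.mul c.2 h1.1
    by_cases hcu : IsUnit c
    · left
      have h1 := hu c hcu
      have : x = (c : L)⁻¹ * y := by rw [hy]; field_simp [h1.2]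
      rw [this]
      exact IsIntegral.mul h1.1 y.2
    refine ih (p.eraseLead + C y * X ^ n) ?_ ?_ ?_
    · refine natDegree_add_le_of_degree_le ?_ (natDegree_C_mul_X_pow_le _ _)
      have := p.eraseLead_natDegree_le
      omega
    · have hkn : k ≠ p.natDegree := by
        rintro rfl
        exact hcu hk
      refine ⟨k, ?_⟩
      rw [coeff_add, eraseLead_coeff_of_ne _ hkn, coeff_C_mul_X_pow]
      split_ifs with h
      · by_contra hcon
        have h2 := (IsLocalRing.maximalIdeal (integralClosure O L)).sub_mem
          ((IsLocalRing.mem_maximalIdeal _).2 hcon) ((IsLocalRing.mem_maximalIdeal _).2 hyu)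
        rw [add_sub_cancel_right] at h2
        exact (IsLocalRing.mem_maximalIdeal _).1 h2 hk
      · simpa using hk
    · have h2 := h0
      rw [← p.eraseLead_add_monomial_natDegree_leadingCoeff, map_add, aeval_monomial, hdeg] at h2
      rw [map_add, map_mul, aeval_C, map_pow, aeval_X, ← h2, pow_succ']
      change _ + (c : L) * x * x ^ n = _ + (c : L) * (x * x ^ n)
      ring

open Polynomial in
theorem aux_prim {O K L : Type*} [CommRing O] [IsDomain O] [ValuationRing O]
    [Field K] [Algebra O K] [IsFractionRing O K]
    [Field L] [Algebra K L] [Algebra.IsAlgebraic K L]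
    [Algebra O L] [IsScalarTower O K L] (x : L) :
    ∃ p : O[X], (∃ k, IsUnit (p.coeff k)) ∧ aeval x p = 0 := by
  classical
  obtain ⟨p, hp0, hp⟩ : IsAlgebraic O x :=
    (IsFractionRing.isAlgebraic_iff O K L).2 (Algebra.IsAlgebraic.isAlgebraic x)
  have hmin : ∀ s : Finset ℕ, s.Nonempty → ∃ k ∈ s, ∀ j ∈ s, p.coeff k ∣ p.coeff j := by
    intro s hs
    induction hs using Finset.Nonempty.cons_induction with
    | singleton a => exact ⟨a, by simp, by simp⟩
    | cons a s ha hs ih =>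
      obtain ⟨k, hk, h⟩ := ih
      rcases ValuationRing.dvd_total (p.coeff k) (p.coeff a) with h1 | h1
      · refine ⟨k, by simp [hk], fun j hj => ?_⟩
        rcases Finset.mem_cons.1 hj with rfl | hj
        · exact h1
        · exact h j hj
      · refine ⟨a, by simp, fun j hj => ?_⟩
        rcases Finset.mem_cons.1 hj with rfl | hj
        · exact dvd_rfl
        · exact h1.trans (h j hj)
  obtain ⟨k, hk, h⟩ := hmin p.support (nonempty_support_iff.2 hp0)
  have hk0 : p.coeff k ≠ 0 := mem_support_iff.1 hk
  obtain ⟨q, hq⟩ : C (p.coeff k) ∣ p := by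
    rw [C_dvd_iff_dvd_coeff]
    intro j
    by_cases hj : j ∈ p.support
    · exact h j hj
    · rw [notMem_support_iff.1 hj]; exact dvd_zero _
  refine ⟨q, ⟨k, ?_⟩, ?_⟩
  · have h1 : p.coeff k = p.coeff k * q.coeff k := by
      conv_lhs => rw [hq, coeff_C_mul]
    have : q.coeff k = 1 := mul_left_cancel₀ hk0 (by rw [← h1, mul_one])
    rw [this]; exact isUnit_one
  · rw [hq, map_mul, aeval_C] at hp
    refine (mul_eq_zero.1 hp).resolve_left ?_
    rw [IsScalarTower.algebraMap_apply O K L]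
    simpa using hk0

theorem aux_fin {O K L : Type*} [CommRing O] [IsDomain O] [ValuationRing O]
    [HenselianLocalRing O] [Field K] [Algebra O K] [IsFractionRing O K]
    [Field L] [Algebra K L] [IsGalois K L] [FiniteDimensional K L]
    [Algebra O L] [IsScalarTower O K L] (x : L) :
    IsIntegral O x ∨ IsIntegral O x⁻¹ := by
  have := aux_local_s2 (O := O) (K := K) (L := L)
  obtain ⟨p, ⟨k, hk⟩, hp⟩ := aux_prim (O := O) (K := K) x
  refine aux_kap x _ (p.map (algebraMap O (integralClosure O L))) le_rfl ⟨k, ?_⟩ ?_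
  · rw [Polynomial.coeff_map]; exact hk.map _
  · rw [Polynomial.aeval_map_algebraMap]; exact hp

theorem aux_all {O K L : Type*} [CommRing O] [IsDomain O] [ValuationRing O]
    [HenselianLocalRing O] [Field K] [Algebra O K] [IsFractionRing O K]
    [Field L] [Algebra K L] [IsGalois K L]
    [Algebra O L] [IsScalarTower O K L] (x : L) :
    IsIntegral O x ∨ IsIntegral O x⁻¹ := by
  let E := FiniteGaloisIntermediateField.adjoin K ({x} : Set L)
  have hx : x ∈ E.toIntermediateField :=
    FiniteGaloisIntermediateField.subset_adjoin K ({x} : Set L) (Set.mem_singleton x)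
  have h := aux_fin (O := O) (K := K) (L := E.toIntermediateField) ⟨x, hx⟩
  let f : E.toIntermediateField →ₐ[O] L := E.toIntermediateField.val.restrictScalars O
  exact h.imp (fun h => h.map f) (fun h => h.map f)

/-- For a henselian valuation ring `O` with fraction field `K` and a Galois extension `L/K`
with `O'` the integral closure of `O` in `L`, the induced map `Spec O' → Spec O` is a
homeomorphism; in particular every prime of `O` has exactly one prime of `O'` over it. -/
theorem statement_2 (O K L : Type*) [CommRing O] [IsDomain O] [ValuationRing O]
    [HenselianLocalRing O] [Field K] [Algebra O K] [IsFractionRing O K]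
    [Field L] [Algebra K L] [IsGalois K L]
    [Algebra O L] [IsScalarTower O K L] :
    IsHomeomorph (PrimeSpectrum.comap (algebraMap O (integralClosure O L))) ∧
      ∀ p : PrimeSpectrum O, ∃! q : PrimeSpectrum (integralClosure O L),
        PrimeSpectrum.comap (algebraMap O (integralClosure O L)) q = p := by
  have hinjOL : Function.Injective (algebraMap O L) := by
    rw [IsScalarTower.algebraMap_eq O K L]
    exact (algebraMap K L).injective.comp (IsFractionRing.injective O K)
  have hinj' : Function.Injective (algebraMap O (integralClosure O L)) := by
    intro a b h
    exact hinjOL (congrArg (Subtype.val) h)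
  have hint : (algebraMap O (integralClosure O L)).IsIntegral :=
    algebraMap_isIntegral_iff.2 inferInstance
  have hle : ∀ I J : Ideal (integralClosure O L), I ≤ J ∨ J ≤ I := by
    intro I J
    by_contra hcon
    rw [not_or, SetLike.not_le_iff_exists, SetLike.not_le_iff_exists] at hcon
    obtain ⟨⟨a, haI, haJ⟩, ⟨b, hbJ, hbI⟩⟩ := hcon
    have ha0 : (a : L) ≠ 0 := fun h => haJ (by
      rw [show a = 0 from Subtype.ext h]; exact J.zero_mem)
    have hb0 : (b : L) ≠ 0 := fun h => hbI (by
      rw [show b = 0 from Subtype.ext h]; exact I.zero_mem)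
    rcases aux_all (O := O) (K := K) ((a : L) / b) with h | h
    · apply haJ
      rw [show a = ⟨_, h⟩ * b from Subtype.ext (by simp [hb0])]
      exact J.mul_mem_left _ hbJ
    · apply hbI
      rw [show b = ⟨_, h⟩ * a from Subtype.ext (by simp [ha0])]
      exact I.mul_mem_left _ haI
  have hinj : Function.Injective (PrimeSpectrum.comap (algebraMap O (integralClosure O L))) := by
    intro q q' h
    have main : ∀ q q' : PrimeSpectrum (integralClosure O L),
        PrimeSpectrum.comap (algebraMap O (integralClosure O L)) q =
        PrimeSpectrum.comap (algebraMap O (integralClosure O L)) q' →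
        q.asIdeal ≤ q'.asIdeal → q = q' := by
      intro q q' h hl
      by_contra hne
      have hlt : q.asIdeal < q'.asIdeal :=
        lt_of_le_of_ne hl fun h => hne (PrimeSpectrum.ext h)
      have := Ideal.IsIntegral.comap_lt_comap (R := O) hlt
      exact this.ne (congrArg PrimeSpectrum.asIdeal h)
    rcases hle q.asIdeal q'.asIdeal with hl | hl
    · exact main q q' h hl
    · exact (main q' q h.symm hl).symm
  have hsurj := hint.comap_surjective hinj'
  have hclosed := PrimeSpectrum.isClosedMap_comap_of_isIntegral _ hint
  refine ⟨?_, fun p => ?_⟩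
  · rw [isHomeomorph_iff_continuous_isClosedMap_bijective]
    exact ⟨PrimeSpectrum.continuous_comap _, hclosed, hinj, hsurj⟩
  · obtain ⟨q, hq⟩ := hsurj p
    exact ⟨q, hq, fun q' hq' => hinj (hq'.trans hq.symm)⟩
end

section
/- Every valuation ring is a filtered union of valuation subrings of finite rank: for every finite subset S of a valuation ring O, there exists a subring O' of O containing S such that O' is itself a valuation ring of finite Krull dimension. (One may take O' = O ∩ F where F is the subfield of the fraction field of O generated by S over the prime field.) -/
/-- `x` is independent modulo `P`, over the image of the integers. -/
def Ind7 {V : Type*} [CommRing V] (P : Ideal V) (n : ℕ) (x : Fin n → V) : Prop :=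
  ∀ f : MvPolynomial (Fin n) ℤ, MvPolynomial.aeval x f ∈ P → ∀ m, ((f.coeff m : ℤ) : V) ∈ P

theorem aeval_mem7 {V : Type*} [CommRing V] {P : Ideal V} {n : ℕ} (x : Fin n → V)
    (f : MvPolynomial (Fin n) ℤ) (h : ∀ m, ((f.coeff m : ℤ) : V) ∈ P) :
    MvPolynomial.aeval x f ∈ P := by
  rw [MvPolynomial.aeval_def, MvPolynomial.eval₂_eq]
  refine Ideal.sum_mem _ fun m _ => Ideal.mul_mem_right _ _ ?_
  simpa using h m

theorem ind7_zero {V : Type*} [CommRing V] (P : Ideal V) (x : Fin 0 → V) : Ind7 P 0 x := by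
  intro f hf m
  obtain ⟨c, rfl⟩ := MvPolynomial.C_surjective (Fin 0) f
  have : m = 0 := Subsingleton.elim _ _
  subst this
  rw [MvPolynomial.coeff_zero_C]
  rw [MvPolynomial.aeval_C] at hf
  simpa using hf

theorem ind7_succ {V : Type*} [CommRing V] {P Q : Ideal V} [hP : P.IsPrime] (hPQ : P ≤ Q)
    (hZ : ∀ c : ℤ, (c : V) ∈ Q → (c : V) ∈ P) {n : ℕ} {x : Fin n → V} (hx : Ind7 Q n x)
    {y : V} (hyQ : y ∈ Q) (hyP : y ∉ P) : Ind7 P (n + 1) (Fin.cons y x) := by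
  have key : ∀ N : ℕ, ∀ F : Polynomial (MvPolynomial (Fin n) ℤ), F.natDegree ≤ N →
      F.eval₂ (MvPolynomial.aeval x : MvPolynomial (Fin n) ℤ →ₐ[ℤ] V).toRingHom y ∈ P →
      ∀ i m, (((F.coeff i).coeff m : ℤ) : V) ∈ P := by
    intro N
    have step : ∀ F : Polynomial (MvPolynomial (Fin n) ℤ),
      F.eval₂ (MvPolynomial.aeval x : MvPolynomial (Fin n) ℤ →ₐ[ℤ] V).toRingHom y ∈ P →
      (∀ m, (((F.coeff 0).coeff m : ℤ) : V) ∈ P) ∧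
      F.divX.eval₂ (MvPolynomial.aeval x : MvPolynomial (Fin n) ℤ →ₐ[ℤ] V).toRingHom y ∈ P := by
      intro F hF
      rw [← Polynomial.divX_mul_X_add F, Polynomial.eval₂_add, Polynomial.eval₂_mul,
        Polynomial.eval₂_X, Polynomial.eval₂_C] at hF
      have h0 : ∀ m, (((F.coeff 0).coeff m : ℤ) : V) ∈ P := by
        intro m
        refine hZ _ (hx _ ?_ m)
        exact (Ideal.add_mem_iff_right _ (Ideal.mul_mem_left _ _ hyQ)).1 (hPQ hF)
      refine ⟨h0, ?_⟩
      have h1 := (Ideal.add_mem_iff_left _ (aeval_mem7 x _ h0)).1 hF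
      exact (hP.mem_or_mem h1).resolve_right hyP
    induction N with
    | zero =>
      intro F hF h i m
      rcases i with _ | i
      · exact (step F h).1 m
      · rw [Polynomial.coeff_eq_zero_of_natDegree_lt (by omega)]; simp
    | succ N ih =>
      intro F hF h i m
      rcases i with _ | i
      · exact (step F h).1 m
      · have := ih F.divX (by rw [Polynomial.natDegree_divX_eq_natDegree_tsub_one]; omega)
          (step F h).2 i m
        simpa using this
  intro f hf m
  have := key _ (MvPolynomial.finSuccEquiv ℤ n f) le_rfl ?_ (m 0) m.tail
  · rwa [MvPolynomial.finSuccEquiv_coeff_coeff, Finsupp.cons_tail] at this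
  · convert hf
    have : ((Polynomial.eval₂RingHom
      (MvPolynomial.aeval x : MvPolynomial (Fin n) ℤ →ₐ[ℤ] V).toRingHom y).comp
        (MvPolynomial.finSuccEquiv ℤ n).toRingEquiv.toRingHom) =
        (MvPolynomial.aeval (Fin.cons y x) : MvPolynomial (Fin (n+1)) ℤ →ₐ[ℤ] V).toRingHom := by
      apply MvPolynomial.ringHom_ext
      · intro r; simp
      · intro i
        refine Fin.cases ?_ (fun i => ?_) i
        · simp [MvPolynomial.finSuccEquiv_X_zero]
        · simp [MvPolynomial.finSuccEquiv_X_succ]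
    exact DFunLike.congr_fun this f

theorem ind7_same {V : Type*} [CommRing V] {P Q : Ideal V} (hPQ : P ≤ Q)
    (hZ : ∀ c : ℤ, (c : V) ∈ Q → (c : V) ∈ P) {n : ℕ} {x : Fin n → V} (hx : Ind7 Q n x) :
    Ind7 P n x := fun f hf m => hZ _ (hx f (hPQ hf) m)

theorem ind7_char {V : Type*} [CommRing V] {P Q : Ideal V} [hP : P.IsPrime] [hQ : Q.IsPrime]
    (hPQ : P ≤ Q) (hZ : ∀ c : ℤ, (c : V) ∈ P → c = 0) {n : ℕ} {x : Fin n → V}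
    (hx : Ind7 Q n x) : Ind7 P n x := by
  obtain ⟨g, hg⟩ : ∃ g : ℤ, Q.comap (Int.castRingHom V) = Ideal.span {g} :=
    (IsPrincipalIdealRing.principal (Q.comap (Int.castRingHom V))).principal
  have hgQ : ∀ c : ℤ, (c : V) ∈ Q ↔ g ∣ c := by
    intro c
    rw [← Ideal.mem_span_singleton, ← hg]; rfl
  have hgu : ¬ IsUnit g := by
    intro h
    have := (hgQ 1).2 h.dvd
    exact hQ.ne_top ((Ideal.eq_top_iff_one _).2 (by simpa using this))
  by_cases hg0 : g = 0
  · refine ind7_same hPQ ?_ hx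
    intro c hc
    have := (hgQ c).1 hc
    rw [hg0, zero_dvd_iff] at this
    simp [this]
  intro f hf m
  by_contra hcon
  have hf0 : f ≠ 0 := by rintro rfl; simp at hcon
  have hCu : ¬ IsUnit (MvPolynomial.C g : MvPolynomial (Fin n) ℤ) := by
    intro h
    apply hgu
    simpa using h.map (MvPolynomial.constantCoeff (R := ℤ) (σ := Fin n))
  obtain ⟨q, hq, hnd⟩ := (FiniteMultiplicity.of_not_isUnit hCu hf0).exists_eq_pow_mul_and_not_dvd
  apply hnd
  rw [MvPolynomial.C_dvd_iff_dvd_coeff]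
  intro i
  rw [← hgQ]
  apply hx
  apply hPQ
  rw [hq, map_mul, map_pow] at hf
  refine (hP.mem_or_mem hf).resolve_left fun h => hg0 (hZ g ?_)
  simpa using hP.mem_of_pow_mem _ h

open Classical in
theorem krull7 {V : Type*} [CommRing V] [IsDomain V] (N : ℕ)
    (hN : ∀ n (x : Fin n → V), Ind7 ⊥ n x → n ≤ N) : ∃ r : ℕ, ringKrullDim V = r := by
  have dich : ∀ P Q : Ideal V, P.IsPrime → Q.IsPrime → P ≤ Q →
      (∀ c : ℤ, (c : V) ∈ P → c = 0) ∨ (∀ c : ℤ, (c : V) ∈ Q → (c : V) ∈ P) := by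
    intro P Q hP hQ hPQ
    by_cases h : P.comap (Int.castRingHom V) = ⊥
    · left
      intro c hc
      have : c ∈ P.comap (Int.castRingHom V) := hc
      rwa [h] at this
    · right
      have h1 : (P.comap (Int.castRingHom V)).IsMaximal :=
        Ideal.IsPrime.isMaximal inferInstance h
      have h2 := h1.eq_of_le (Ideal.IsPrime.ne_top (inferInstance :
        (Q.comap (Int.castRingHom V)).IsPrime)) (Ideal.comap_mono hPQ)
      intro c hc
      have : c ∈ Q.comap (Int.castRingHom V) := hc
      rw [← h2] at this
      exact this
  have mono : ∀ P Q : Ideal V, P.IsPrime → Q.IsPrime → P ≤ Q → ∀ n x, Ind7 Q n x → Ind7 P n x := by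
    intro P Q hP hQ hPQ n x hx
    rcases dich P Q hP hQ hPQ with h | h
    · exact ind7_char hPQ h hx
    · exact ind7_same hPQ h hx
  have bd : ∀ P : Ideal V, P.IsPrime → ∀ n x, Ind7 P n x → n ≤ N := fun P hP n x hx =>
    hN n x (mono ⊥ P Ideal.isPrime_bot hP bot_le n x hx)
  let d : Ideal V → ℕ := fun P => Nat.findGreatest (fun n => ∃ x, Ind7 P n x) N
  have dspec : ∀ P, ∃ x, Ind7 P (d P) x := fun P =>
    Nat.findGreatest_spec (P := fun n => ∃ x, Ind7 P n x) (Nat.zero_le N)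
      ⟨Fin.elim0, ind7_zero P _⟩
  have dle : ∀ P : Ideal V, P.IsPrime → ∀ n x, Ind7 P n x → n ≤ d P := fun P hP n x hx =>
    Nat.le_findGreatest (bd P hP n x hx) ⟨x, hx⟩
  let e : PrimeSpectrum V → ℕ := fun P =>
    d P.asIdeal + if (∀ c : ℤ, (c : V) ∈ P.asIdeal → c = 0) then 1 else 0
  have ebd : ∀ P, e P ≤ N + 1 := by
    intro P
    have : d P.asIdeal ≤ N := Nat.findGreatest_le _
    simp only [e]
    split_ifs <;> omega
  have eanti : ∀ P Q : PrimeSpectrum V, P < Q → e Q < e P := by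
    intro P Q hPQ
    have hP := P.2
    have hQ := Q.2
    have hlt : P.asIdeal < Q.asIdeal := hPQ
    obtain ⟨x, hx⟩ := dspec Q.asIdeal
    by_cases hZ : ∀ c : ℤ, (c : V) ∈ Q.asIdeal → (c : V) ∈ P.asIdeal
    · obtain ⟨y, hyQ, hyP⟩ := Set.exists_of_ssubset hlt
      have h1 := dle _ hP _ _ (ind7_succ hlt.le hZ hx hyQ hyP)
      have h2 : (∀ c : ℤ, (c : V) ∈ Q.asIdeal → c = 0) ↔ (∀ c : ℤ, (c : V) ∈ P.asIdeal → c = 0) :=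
        ⟨fun h c hc => h c (hlt.le hc), fun h c hc => h c (hZ c hc)⟩
      simp only [e, h2]
      omega
    · have h0 := (dich _ _ hP hQ hlt.le).resolve_right hZ
      have h1 := dle _ hP _ _ (mono _ _ hP hQ hlt.le _ x hx)
      have h2 : ¬ (∀ c : ℤ, (c : V) ∈ Q.asIdeal → c = 0) := by
        intro h
        apply hZ
        intro c hc
        simp [h c hc]
      simp only [e, if_pos h0, if_neg h2]
      omega
  have hle : ringKrullDim V ≤ ((N + 1 : ℕ) : WithBot ℕ∞) := by
    refine iSup_le fun l => ?_
    have : ∀ i : ℕ, ∀ hi : i < l.length + 1, e (l ⟨i, hi⟩) + i ≤ N + 1 := by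
      intro i
      induction i with
      | zero => intro hi; exact ebd _
      | succ i ih =>
        intro hi
        have h1 := ih (by omega)
        have h2 := eanti _ _ (l.strictMono (show (⟨i, by omega⟩ : Fin (l.length + 1)) < ⟨i+1, hi⟩ by simp))
        omega
    have := this l.length (by omega)
    have h3 : l.length ≤ N + 1 := by omega
    exact_mod_cast h3
  have hge : (0 : WithBot ℕ∞) ≤ ringKrullDim V := ringKrullDim_nonneg_of_nontrivial
  generalize ringKrullDim V = D at hle hge
  induction D with
  | bot => simp at hge
  | coe D =>
    have h : D ≤ ((N + 1 : ℕ) : ℕ∞) := by exact_mod_cast hle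
    lift D to ℕ using (ne_top_of_le_ne_top (ENat.natCast_ne_top _) h)
    exact ⟨D, rfl⟩

theorem trdeg7 {K : Type*} [Field K] (S : Finset K) (n : ℕ)
    (x : Fin n → Subfield.closure (S : Set K))
    (hx : ∀ f : MvPolynomial (Fin n) ℤ, MvPolynomial.aeval x f = 0 → ∀ m, ((f.coeff m : ℤ) : K) = 0) :
    n ≤ S.card := by
  let F := Subfield.closure (S : Set K)
  let R := (Int.castRingHom F).range
  let T : Set F := Subtype.val ⁻¹' (S : Set K)
  have hind : AlgebraicIndependent R x := by
    rw [algebraicIndependent_iff]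
    intro p hp
    obtain ⟨f, rfl⟩ := MvPolynomial.map_surjective (Int.castRingHom F).rangeRestrict
      (Int.castRingHom F).rangeRestrict_surjective p
    rw [MvPolynomial.aeval_def, MvPolynomial.eval₂_map] at hp
    have h := hx f (by
      rw [MvPolynomial.aeval_def, ← hp]
      congr 1)
    ext m
    rw [MvPolynomial.coeff_map]
    have := h m
    simpa using this
  have halg : Algebra.IsAlgebraic (Algebra.adjoin R T) F := by
    constructor
    rintro ⟨y, hy⟩
    induction hy using Subfield.closure_induction with
    | mem y hy =>
      exact isAlgebraic_algebraMap (⟨⟨y, _⟩, Algebra.subset_adjoin hy⟩ : Algebra.adjoin R T)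
    | one => exact isAlgebraic_one
    | add a b ha hb iha ihb => exact iha.add ihb
    | neg a ha iha => exact iha.neg
    | inv a ha iha => exact iha.inv
    | mul a b ha hb iha ihb => exact iha.mul ihb
  have h1 := Algebra.IsAlgebraic.trdeg_le_cardinalMk R T
  have h2 := hind.lift_cardinalMk_le_trdeg
  have h3 : Cardinal.mk T ≤ S.card := by
    have : Cardinal.mk T ≤ Cardinal.mk (S : Set K) :=
      Cardinal.mk_preimage_of_injective _ _ Subtype.val_injective
    simpa using this
  have h4 := h1.trans h3
  simp at h2
  exact_mod_cast h2.trans h4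

/-- Every valuation ring is a filtered union of valuation subrings of finite rank: every
finite subset is contained in a subring which is a valuation ring of finite Krull
dimension. -/
theorem statement_7 (O : Type*) [CommRing O] [IsDomain O] [ValuationRing O]
    (S : Finset O) :
    ∃ O' : Subring O, (S : Set O) ⊆ O' ∧ ValuationRing O' ∧
      ∃ r : ℕ, ringKrullDim O' = r := by
  classical
  let K := FractionRing O
  let S' : Finset K := S.image (algebraMap O K)
  let F := Subfield.closure (S' : Set K)
  let O' : Subring O := F.toSubring.comap (algebraMap O K)
  have hinj : Function.Injective (algebraMap O K) := IsFractionRing.injective O K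
  refine ⟨O', ?_, ?_, ?_⟩
  · intro s hs
    exact Subfield.subset_closure (Finset.mem_coe.2 (Finset.mem_image_of_mem _ hs))
  · have aux : ∀ a b : O', ∀ c : O, (a : O) * c = b → ∃ c : O', a * c = b := by
      intro a b c h
      by_cases ha : (a : O) = 0
      · refine ⟨0, Subtype.ext ?_⟩
        rw [← h]; simp [ha]
      · refine ⟨⟨c, ?_⟩, Subtype.ext h⟩
        have hc : algebraMap O K c = algebraMap O K b / algebraMap O K a := by
          rw [eq_div_iff (by simpa using ha), ← h, map_mul, mul_comm]
        change algebraMap O K c ∈ F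
        rw [hc]
        exact div_mem b.2 a.2
    refine { cond' := fun a b => ?_ }
    obtain ⟨c, h | h⟩ := ValuationRing.cond (a : O) (b : O)
    · obtain ⟨c, h⟩ := aux a b c h
      exact ⟨c, Or.inl h⟩
    · obtain ⟨c, h⟩ := aux b a c h
      exact ⟨c, Or.inr h⟩
  · refine krull7 S'.card fun n x hx => ?_
    let φ : O' →+* F := ((algebraMap O K).comp O'.subtype).codRestrict F.toSubring (fun a => a.2)
    have hφ : Function.Injective φ := by
      intro a b hab
      exact Subtype.ext (hinj (congrArg Subtype.val hab))
    refine trdeg7 S' n (fun i => φ (x i)) fun f hf m => ?_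
    have h1 : φ (MvPolynomial.aeval x f) = 0 := by
      rw [← hf]
      exact MvPolynomial.comp_aeval_apply (φ := φ.toIntAlgHom) x f
    have h2 := hx f (by simpa using hφ (h1.trans (map_zero φ).symm)) m
    have h3 : ((f.coeff m : ℤ) : O') = 0 := by simpa using h2
    have h4 : φ ((f.coeff m : ℤ) : O') = 0 := by rw [h3, map_zero]
    rw [map_intCast] at h4
    simpa using congrArg Subtype.val h4
end

section
/- Let O be a valuation ring and let a ∈ O be a nonzero non-unit. Let R = O[X, Y] be the polynomial ring in two variables over O, and let I = (a) be the principal ideal of R generated by (the image of) a. Then the first local cohomology module H¹_I(R) is nonzero. Equivalently, the localization map R → R[1/a] is not surjective, and in the exact sequence 0 → Γ_I(R) → R → R[1/a] → H¹_I(R) → 0 the last term does not vanish. -/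
open CategoryTheory Limits Opposite

universe u
namespace LC10
variable {R : Type u} [CommRing R]

/-- terms of the Koszul resolution -/
noncomputable def KX (R : Type u) [CommRing R] : ℕ → ModuleCat.{u} R
  | 0 => ModuleCat.of R R
  | 1 => ModuleCat.of R R
  | _ + 2 => ModuleCat.of R PUnit.{u+1}

noncomputable def Kd (g : R) : ∀ n, KX R (n + 1) ⟶ KX R n
  | 0 => ModuleCat.ofHom (LinearMap.mulLeft R g)
  | _ + 1 => 0

/-- The Koszul complex `R → R` given by multiplication by `g`. -/
noncomputable def K (g : R) : ChainComplex (ModuleCat.{u} R) ℕ :=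
  ChainComplex.of (KX R) (Kd g) (fun n => by
    show (0 : KX R (n + 2) ⟶ KX R (n+1)) ≫ Kd g n = 0
    simp)

lemma K_d_one_zero (g : R) : (K g).d 1 0 = ModuleCat.ofHom (LinearMap.mulLeft R g) :=
  ChainComplex.of_d (KX R) (Kd g) 0

lemma K_isZero (g : R) (n : ℕ) : IsZero ((K g).X (n + 2)) :=
  ModuleCat.isZero_of_subsingleton (ModuleCat.of R PUnit.{u+1})

instance K_proj (g : R) (n : ℕ) : Projective ((K g).X n) :=
  match n with
  | 0 => inferInstanceAs (Projective (ModuleCat.of R R))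
  | 1 => inferInstanceAs (Projective (ModuleCat.of R R))
  | n + 2 => (K_isZero g n).projective

/-- augmentation -/
noncomputable def Kπ (g : R) (I : Ideal R) (hI : I = Ideal.span {g}) :
    K g ⟶ (ChainComplex.single₀ _).obj (ModuleCat.of R (R ⧸ I)) :=
  (ChainComplex.toSingle₀Equiv _ _).symm ⟨(ModuleCat.ofHom I.mkQ : ModuleCat.of R R ⟶ _), by
    rw [K_d_one_zero]
    ext
    show I.mkQ (g * 1) = 0
    simp [hI, Ideal.Quotient.eq_zero_iff_mem]⟩

lemma Kπ_f_zero (g : R) (I : Ideal R) (hI : I = Ideal.span {g}) :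
    (Kπ g I hI).f 0 = ModuleCat.ofHom I.mkQ :=
  ChainComplex.toSingle₀Equiv_symm_apply_f_zero _ _

lemma Kπ_quasiIso [IsDomain R] (g : R) (hg : g ≠ 0) (I : Ideal R) (hI : I = Ideal.span {g}) :
    QuasiIso (Kπ g I hI) where
  quasiIsoAt m := by
    match m with
    | 0 =>
      rw [ChainComplex.quasiIsoAt₀_iff, ShortComplex.quasiIso_iff_of_zeros' _ rfl rfl rfl]
      constructor
      · rw [ShortComplex.moduleCat_exact_iff]
        intro (x : R) hx
        replace hx : ((Kπ g I hI).f 0) x = 0 := hx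
        rw [Kπ_f_zero] at hx
        replace hx : I.mkQ x = 0 := hx
        replace hx : x ∈ I := (Submodule.Quotient.mk_eq_zero I).1 hx
        rw [hI, Ideal.mem_span_singleton] at hx
        obtain ⟨y, rfl⟩ := hx
        refine ⟨(y : R), ?_⟩
        show (K g).d 1 0 y = _
        rw [K_d_one_zero]
        rfl
      · rw [ModuleCat.epi_iff_surjective]
        show Function.Surjective ((Kπ g I hI).f 0)
        rw [Kπ_f_zero]
        exact Submodule.mkQ_surjective _
    | 1 =>
      rw [quasiIsoAt_iff_exactAt' (hL := ChainComplex.exactAt_succ_single_obj ..),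
          HomologicalComplex.exactAt_iff' _ 2 1 0 (by simp) (by simp)]
      rw [ShortComplex.moduleCat_exact_iff]
      intro (x : R) hx
      replace hx : (K g).d 1 0 x = 0 := hx
      rw [K_d_one_zero] at hx
      replace hx : g * x = 0 := hx
      obtain rfl : x = 0 := by simpa [hg] using hx
      exact ⟨0, map_zero _⟩
    | m + 2 =>
      rw [quasiIsoAt_iff_exactAt' (hL := ChainComplex.exactAt_succ_single_obj ..),
          HomologicalComplex.exactAt_iff]
      exact ShortComplex.exact_of_isZero_X₂ _ (K_isZero g m)

noncomputable def res [IsDomain R] (g : R) (hg : g ≠ 0) (I : Ideal R) (hI : I = Ideal.span {g}) :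
    ProjectiveResolution (ModuleCat.of R (R ⧸ I)) where
  complex := K g
  projective := K_proj g
  π := Kπ g I hI
  quasiIso := Kπ_quasiIso g hg I hI

/-- comparison -/
noncomputable def Kmap (g' h : R) : K (g' * h) ⟶ K g' :=
  ChainComplex.mkHom _ _ (𝟙 (ModuleCat.of R R))
    (ModuleCat.ofHom (LinearMap.mulLeft R h) : ModuleCat.of R R ⟶ ModuleCat.of R R)
    (by rw [K_d_one_zero, K_d_one_zero]; ext; show g' * (h * 1) = g' * h * 1; ring)
    (fun n p => ⟨0, (K_isZero _ n).eq_of_src _ _⟩)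

noncomputable abbrev L (g : R) := (K g).linearYonedaObj R (ModuleCat.of R R)

noncomputable abbrev Lmap (g' h : R) : L g' ⟶ L (g' * h) :=
  (HomologicalComplex.unopFunctor _ _).map
    ((((linearYoneda R (ModuleCat R)).obj (ModuleCat.of R R)).rightOp.mapHomologicalComplex _).map (Kmap g' h)).op

lemma L_d (g : R) (w : ModuleCat.of R R ⟶ ModuleCat.of R R) :
    (L g).d 0 1 w = ModuleCat.ofHom (LinearMap.mulLeft R g) ≫ w := by
  rw [ChainComplex.linearYonedaObj_d, K_d_one_zero]
  rfl

lemma range_d (g : R) (x : ModuleCat.of R R ⟶ ModuleCat.of R R) :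
    (L g).pOpcycles 1 x = 0 ↔ g ∣ x.hom (1 : R) := by
  have key : (L g).pOpcycles 1 x = 0 ↔ ∃ w : ModuleCat.of R R ⟶ ModuleCat.of R R, (L g).d 0 1 w = x := by
    have h1 := ShortComplex.moduleCat_pOpcycles_eq_zero_iff ((L g).sc' 0 1 2) x
    have h2 := ConcreteCategory.congr_hom
      ((L g).pOpcycles_opcyclesIsoSc'_hom 0 1 2 (by simp) (by simp)) x
    replace h2 : ((L g).opcyclesIsoSc' 0 1 2 (by simp) (by simp)).hom
      ((L g).pOpcycles 1 x) = ((L g).sc' 0 1 2).pOpcycles x := h2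
    have h3 := (injective_iff_map_eq_zero' _).1 ((ModuleCat.mono_iff_injective
      ((L g).opcyclesIsoSc' 0 1 2 (by simp) (by simp)).hom).1 inferInstance) ((L g).pOpcycles 1 x)
    rw [← h3, h2]
    exact h1
  rw [key]
  constructor
  · rintro ⟨w, rfl⟩
    rw [L_d]
    refine ⟨w.hom (1 : R), ?_⟩
    show w.hom (g * 1) = _
    rw [← smul_eq_mul g, map_smul, smul_eq_mul]
  · rintro ⟨c, hc⟩
    refine ⟨ModuleCat.ofHom (LinearMap.mulLeft R c), ?_⟩
    rw [L_d]
    refine ModuleCat.hom_ext (LinearMap.ext_ring ?_)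
    show c * (g * 1) = x.hom (1 : R)
    rw [hc]; ring

lemma mono_homologyMap [IsDomain R] (g' h : R) (hh : h ≠ 0) :
    Mono (HomologicalComplex.homologyMap (Lmap g' h) 1) := by
  suffices Mono (HomologicalComplex.opcyclesMap (Lmap g' h) 1) from
    mono_of_mono_fac (HomologicalComplex.homologyι_naturality (Lmap g' h) 1)
  rw [ModuleCat.mono_iff_injective, injective_iff_map_eq_zero]
  intro y hy
  obtain ⟨x, rfl⟩ := (ModuleCat.epi_iff_surjective ((L g').pOpcycles 1)).1 inferInstance y
  have := HomologicalComplex.p_opcyclesMap (Lmap g' h) 1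
  replace this := ConcreteCategory.congr_hom this x
  simp only [ConcreteCategory.comp_apply] at this
  rw [hy] at this
  have h2 := (range_d _ _).1 this.symm
  refine (range_d g' x).2 ?_
  change ModuleCat.of R R ⟶ ModuleCat.of R R at x
  change g' * h ∣ x.hom (h * 1 : R) at h2
  rw [← smul_eq_mul h, map_smul, smul_eq_mul, mul_comm] at h2
  exact (mul_dvd_mul_iff_left hh).1 h2

lemma nontrivial_homology (g : R) (hu : ¬ IsUnit g) :
    Nontrivial ((L g).homology 1) := by
  have i : IsIso ((L g).homologyι 1) := HomologicalComplex.isIso_homologyι _ 1 2 (by simp) (by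
    ext x
    exact (K_isZero g 0).eq_of_src _ _)
  have hn : Nontrivial ((L g).opcycles 1) := by
    refine ⟨(L g).pOpcycles 1 (𝟙 (ModuleCat.of R R)), 0, fun h => hu ?_⟩
    exact isUnit_of_dvd_one ((range_d g _).1 h)
  exact ((asIso ((L g).homologyι 1)).toLinearEquiv).toEquiv.nontrivial

lemma epi_of_sq {C : Type*} [Category* C] {X Y X' Y' : C} (f : X ⟶ Y) (f' : X' ⟶ Y')
    (e : X ≅ X') (e' : Y ≅ Y') (w : f ≫ e'.hom = e.hom ≫ f') (h : Epi f') : Epi f := by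
  rw [← Iso.eq_comp_inv, Category.assoc] at w
  rw [w]
  infer_instance

lemma ext_mono [IsDomain R] (g' h : R) (hg : g' ≠ 0) (hh : h ≠ 0) (I I' : Ideal R)
    (hI : I = Ideal.span {g' * h}) (hI' : I' = Ideal.span {g'})
    (φ : ModuleCat.of R (R ⧸ I) ⟶ ModuleCat.of R (R ⧸ I'))
    (hφ : ModuleCat.ofHom I.mkQ ≫ φ = ModuleCat.ofHom I'.mkQ) :
    Mono (((Ext R (ModuleCat.{u} R) 1).map φ.op).app (ModuleCat.of R R)) := by
  have key := ProjectiveResolution.isoLeftDerivedObj_hom_naturality φ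
    (res (g' * h) (mul_ne_zero hg hh) I hI) (res g' hg I' hI') (Kmap g' h) (by
      show (Kmap g' h).f 0 ≫ (Kπ g' I' hI').f 0 = (Kπ _ I hI).f 0 ≫ _
      rw [Kπ_f_zero, Kπ_f_zero]
      exact hφ.symm)
     ((linearYoneda R (ModuleCat R)).obj (ModuleCat.of R R)).rightOp 1
  have h1 := HomologicalComplex.homologyOp_hom_naturality (Lmap g' h) 1
  have h2 := mono_homologyMap g' h hh
  have h3 : Epi (HomologicalComplex.homologyMap
      ((HomologicalComplex.opFunctor _ _).map (Lmap g' h).op) 1) := by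
    exact epi_of_sq _ _ (HomologicalComplex.homologyOp (L (g' * h)) 1)
      (HomologicalComplex.homologyOp (L g') 1) h1 inferInstance
  have h4 : Epi ((((linearYoneda R (ModuleCat R)).obj
      (ModuleCat.of R R)).rightOp.leftDerived 1).map φ) := by
    have : Epi ((((linearYoneda R (ModuleCat R)).obj
      (ModuleCat.of R R)).rightOp.mapHomologicalComplex _ ⋙
        HomologicalComplex.homologyFunctor _ (ComplexShape.down ℕ) 1).map (Kmap g' h)) := h3
    exact epi_of_sq _ _ _ _ key this
  exact @unop_mono_of_epi _ _ _ _ _ h4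

lemma ext_nontrivial [IsDomain R] (g : R) (hg : g ≠ 0) (hu : ¬ IsUnit g) (I : Ideal R)
    (hI : I = Ideal.span {g}) :
    Nontrivial (((Ext R (ModuleCat.{u} R) 1).obj (op (ModuleCat.of R (R ⧸ I)))).obj
      (ModuleCat.of R R)) := by
  have := nontrivial_homology g hu
  exact @Equiv.nontrivial _ _ (((res g hg I hI).isoExt 1 (ModuleCat.of R R)).toLinearEquiv).toEquiv this

lemma colimit_nontrivial {D : Type} [SmallCategory D] [IsFiltered D]
    (F : D ⥤ ModuleCat.{u} R ⥤ ModuleCat.{u} R) (M : ModuleCat.{u} R) (j : D)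
    (hn : Nontrivial ((F.obj j).obj M)) (hm : ∀ (k : D) (f : j ⟶ k), Mono ((F.map f).app M)) :
    Nontrivial ((colimit F).obj M) := by
  let c := ((evaluation _ (ModuleCat R)).obj M).mapCocone (colimit.cocone F)
  have hc : IsColimit c := isColimitOfPreserves _ (colimit.isColimit F)
  have : PreservesFilteredColimitsOfSize.{0, 0} (forget (ModuleCat.{u} R)) :=
    preservesFilteredColimitsOfSize_shrink.{0, u, 0, u} _
  have : PreservesColimitsOfShape D (forget (ModuleCat.{u} R)) :=
    PreservesFilteredColimitsOfSize.preserves_filtered_colimits D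
  obtain ⟨x, hx⟩ := exists_ne (0 : (F.obj j).obj M)
  refine ⟨c.ι.app j x, 0, fun h0 => hx ?_⟩
  obtain ⟨k, f, f', hk⟩ := Concrete.isColimit_exists_of_rep_eq
    (F ⋙ (evaluation _ (ModuleCat R)).obj M) hc x
    (0 : (F.obj j).obj M) (h0.trans (map_zero _).symm)
  replace hk := hk.trans (map_zero _)
  exact (injective_iff_map_eq_zero _).1 ((ModuleCat.mono_iff_injective _).1 (hm k f)) x hk

lemma main [IsDomain R] (g : R) (hg : g ≠ 0) (hu : ¬ IsUnit g) :
    Nontrivial ((localCohomology (Ideal.span {g}) 1).obj (ModuleCat.of R R)) := by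
  refine colimit_nontrivial
    (localCohomology.diagram (localCohomology.idealPowersDiagram (Ideal.span {g})) 1)
    (ModuleCat.of R R) (op (op 1)) ?_ ?_
  · exact ext_nontrivial g hg hu ((Ideal.span {g}) ^ 1) (pow_one _)
  · intro k f
    have hle : 1 ≤ k.unop.unop := f.unop.unop.down.down
    obtain ⟨m, hm⟩ := Nat.exists_eq_add_of_le hle
    exact ext_mono g (g ^ m) hg (pow_ne_zero _ hg) (Ideal.span {g} ^ k.unop.unop)
      (Ideal.span {g} ^ 1) (by rw [Ideal.span_singleton_pow, hm, pow_add, pow_one]) (pow_one _)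
      ((localCohomology.ringModIdeals
        (localCohomology.idealPowersDiagram (Ideal.span {g}))).map f.unop)
      (by ext; rfl)
end LC10

theorem statement_10 (O : Type*) [CommRing O] [IsDomain O] [ValuationRing O]
    (a : O) (ha : a ≠ 0) (hu : ¬ IsUnit a) :
    Nontrivial ((localCohomology
        (Ideal.span {(MvPolynomial.C a : MvPolynomial (Fin 2) O)}) 1).obj
      (ModuleCat.of (MvPolynomial (Fin 2) O) (MvPolynomial (Fin 2) O))) ∧
      ¬ Function.Surjective (algebraMap (MvPolynomial (Fin 2) O)
        (Localization.Away (MvPolynomial.C a : MvPolynomial (Fin 2) O))) := by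
  have hC : (MvPolynomial.C a : MvPolynomial (Fin 2) O) ≠ 0 := by simpa using ha
  have hCu : ¬ IsUnit (MvPolynomial.C a : MvPolynomial (Fin 2) O) := fun h => hu (by
    simpa using h.map (MvPolynomial.constantCoeff (R := O) (σ := Fin 2)))
  refine ⟨LC10.main _ hC hCu, fun hs => hCu ?_⟩
  have hunit := IsLocalization.Away.algebraMap_isUnit
    (S := Localization.Away (MvPolynomial.C a : MvPolynomial (Fin 2) O))
    (MvPolynomial.C a : MvPolynomial (Fin 2) O)
  obtain ⟨b, hb⟩ := hunit.exists_right_inv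
  obtain ⟨p, rfl⟩ := hs b
  rw [← map_mul] at hb
  have hinj : Function.Injective (algebraMap (MvPolynomial (Fin 2) O)
        (Localization.Away (MvPolynomial.C a : MvPolynomial (Fin 2) O))) :=
    IsLocalization.injective _ (powers_le_nonZeroDivisors_of_noZeroDivisors hC)
  exact IsUnit.of_mul_eq_one _ (hinj (hb.trans (map_one _).symm))
end
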